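/- arXiv:1601.06110 — 2 statements merged into one kernel-verified Lean document; each statement's English description precedes it below -/
import Mathlib

section
/- A polynomial P ∈ K[x] satisfies P([n]_q) ∈ ℤ[q,q⁻¹] for all n ∈ ℤ if and only if P lies in the ℤ[q,q⁻¹]-linear span of the q-binomial coefficient polynomials B_q(k), k ∈ ℕ. Equivalently, R_q = R_q^+ ⊗_{ℤ[q]} ℤ[q,q⁻¹] inside K[x]: every P ∈ R_q is of the form q^{−m}·P₀ for some m ∈ ℕ and P₀ ∈ R_q^+. -/
open Polynomial

noncomputable section

/-- `K = ℚ(q)`, the field of rational functions in `q` over `ℚ`. -/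
abbrev K : Type := RatFunc ℚ

/-- The variable `q ∈ K`. -/
def qq : K := RatFunc.X

/-- The quantum integer `[n]_q = (q^n - 1)/(q - 1) ∈ K`, for `n ∈ ℤ`. -/
def qInt (n : ℤ) : K := (qq ^ n - 1) / (qq - 1)

/-- The quantum factorial `[n]_q! = ∏_{i=1}^n [i]_q`. -/
def qFact (n : ℕ) : K := ∏ i ∈ Finset.range n, qInt ((i : ℤ) + 1)

/-- The `q`-binomial coefficient polynomial `B_q(k) ∈ K[x]`, with `B_q(0) = 1`. -/
def Bq (k : ℕ) : K[X] :=
  C ((qq ^ (k.choose 2) * qFact k)⁻¹) * ∏ i ∈ Finset.range k, (X - C (qInt i))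

/-- The subring `ℤ[q]` of `K`. -/
def Zq : Subring K := Subring.closure {qq}

/-- The subring `ℤ[q,q⁻¹]` of Laurent polynomials in `q` inside `K`. -/
def ZqL : Subring K := Subring.closure {qq, qq⁻¹}

lemma qq_ne_zero : qq ≠ 0 := RatFunc.X_ne_zero

lemma qq_pow_ne_one (n : ℕ) (hn : n ≠ 0) : qq ^ n ≠ 1 := by
  intro h
  have h2 : algebraMap ℚ[X] (RatFunc ℚ) (X ^ n) = algebraMap ℚ[X] (RatFunc ℚ) 1 := by
    rw [map_pow, map_one, RatFunc.algebraMap_X]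
    exact h
  have h3 := RatFunc.algebraMap_injective ℚ h2
  have h4 := congrArg Polynomial.natDegree h3
  simp at h4
  exact hn h4

lemma qq_sub_one_ne : qq - 1 ≠ 0 := by
  have := qq_pow_ne_one 1 one_ne_zero
  rw [pow_one] at this
  exact sub_ne_zero.mpr this

lemma qInt_succ_ne (k : ℕ) : qInt ((k : ℤ) + 1) ≠ 0 := by
  unfold qInt
  refine div_ne_zero (sub_ne_zero.mpr ?_) qq_sub_one_ne
  have := qq_pow_ne_one (k + 1) (Nat.succ_ne_zero k)
  exact_mod_cast this

lemma qInt_zero : qInt 0 = 0 := by simp [qInt]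

lemma qInt_sub (n : ℤ) (k : ℕ) : qInt n - qInt k = qq ^ k * qInt (n - k) := by
  unfold qInt
  have h1 := qq_sub_one_ne
  have h2 := qq_ne_zero
  rw [zpow_sub₀ h2, zpow_natCast]
  field_simp
  ring

lemma qInt_inj : Function.Injective (fun n : ℕ => qInt (n : ℤ)) := by
  have key : ∀ a b : ℕ, a < b → qInt (a : ℤ) ≠ qInt (b : ℤ) := by
    intro a b hab h
    have h1 := qInt_sub b a
    rw [h, sub_self] at h1
    obtain ⟨d, rfl⟩ := Nat.exists_eq_add_of_lt hab
    have h2 : (((a + d + 1 : ℕ) : ℤ) - a) = (d : ℤ) + 1 := by push_cast; ring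
    rw [h2] at h1
    exact mul_ne_zero (pow_ne_zero _ qq_ne_zero) (qInt_succ_ne d) h1.symm
  intro a b h
  rcases lt_trichotomy a b with h' | h' | h'
  · exact absurd h (key a b h')
  · exact h'
  · exact absurd h.symm (key b a h')

lemma Bq_zero : Bq 0 = 1 := by simp [Bq, qFact]

/-- The value of `B_q(k)` at `[n]_q`. -/
def bv (k : ℕ) (n : ℤ) : K := (Bq k).eval (qInt n)

lemma bv_zero (n : ℤ) : bv 0 n = 1 := by simp [bv, Bq_zero]

lemma bv_succ (k : ℕ) (n : ℤ) :
    bv (k + 1) n = bv k n * qInt (n - k) / qInt ((k : ℤ) + 1) := by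
  unfold bv Bq
  simp only [eval_mul, eval_C, Finset.prod_range_succ, qFact, eval_sub, eval_X]
  rw [qInt_sub, Nat.choose_succ_succ' k 1, Nat.choose_one_right, pow_add]
  have h2 := qq_ne_zero
  have h3 := qInt_succ_ne k
  have h4 : (∏ i ∈ Finset.range k, qInt ((i : ℤ) + 1)) ≠ 0 :=
    Finset.prod_ne_zero_iff.mpr fun i _ => qInt_succ_ne i
  field_simp

lemma bv_shift (k : ℕ) (n : ℤ) :
    bv (k + 1) (n + 1) = bv k n * qInt (n + 1) / qInt ((k : ℤ) + 1) := by
  induction k with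
  | zero => rw [bv_succ]; simp [bv_zero]
  | succ k ih =>
    rw [bv_succ, ih, bv_succ k n]
    have h : n + 1 - ((k + 1 : ℕ) : ℤ) = n - k := by push_cast; ring
    rw [h]
    ring

lemma bv_pascal (k : ℕ) (n : ℤ) :
    bv (k + 1) (n + 1) = bv k n + qq ^ (k + 1) * bv (k + 1) n := by
  rw [bv_shift, bv_succ]
  have h3 := qInt_succ_ne k
  have h := qInt_sub (n + 1) (k + 1)
  have e : n + 1 - ((k + 1 : ℕ) : ℤ) = n - k := by push_cast; ring
  rw [e] at h
  push_cast at h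
  field_simp
  linear_combination bv k n * h

lemma bv_succ_zero (k : ℕ) : bv (k + 1) 0 = 0 := by
  induction k with
  | zero => rw [bv_succ]; simp [qInt_zero]
  | succ k ih => rw [bv_succ, ih]; simp

lemma bv_self (k : ℕ) : bv k k = 1 := by
  induction k with
  | zero => exact bv_zero _
  | succ k ih =>
    push_cast
    rw [bv_shift, ih, one_mul, div_self (qInt_succ_ne k)]

lemma bv_lt (k : ℕ) : ∀ n : ℕ, n < k → bv k n = 0 := by
  induction k with
  | zero => intro n hn; omega
  | succ k ih =>
    intro n hn
    rcases n with _ | n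
    · exact bv_succ_zero k
    · push_cast
      rw [bv_shift, ih n (by omega)]
      simp

lemma qq_mem_Zq : qq ∈ Zq := Subring.subset_closure rfl
lemma qq_mem_ZqL : qq ∈ ZqL := Subring.subset_closure (by simp)
lemma qq_inv_mem_ZqL : qq⁻¹ ∈ ZqL := Subring.subset_closure (by simp)

lemma bv_mem_Zq (k : ℕ) : ∀ n : ℕ, bv k n ∈ Zq := by
  induction k with
  | zero => intro n; rw [bv_zero]; exact one_mem _
  | succ k ih =>
    intro n
    induction n with
    | zero => rw [Nat.cast_zero, bv_succ_zero]; exact zero_mem _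
    | succ n ihn =>
      push_cast
      rw [bv_pascal]
      exact add_mem (ih n) (mul_mem (pow_mem qq_mem_Zq _) ihn)

lemma bv_mem_ZqL (k : ℕ) : ∀ n : ℤ, bv k n ∈ ZqL := by
  induction k with
  | zero => intro n; rw [bv_zero]; exact one_mem _
  | succ k ih =>
    intro n
    induction n using Int.induction_on with
    | zero => rw [bv_succ_zero]; exact zero_mem _
    | succ n ihn =>
      rw [bv_pascal]
      exact add_mem (ih n) (mul_mem (pow_mem qq_mem_ZqL _) ihn)
    | pred n ihn =>
      have h := bv_pascal k (-(n : ℤ) - 1)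
      rw [sub_add_cancel] at h
      have e : bv (k + 1) (-(n : ℤ) - 1)
          = qq⁻¹ ^ (k + 1) * (bv (k + 1) (-(n : ℤ)) - bv k (-(n : ℤ) - 1)) := by
        rw [h, add_sub_cancel_left, inv_pow, inv_mul_cancel_left₀ (pow_ne_zero _ qq_ne_zero)]
      rw [e]
      exact mul_mem (pow_mem qq_inv_mem_ZqL _) (sub_mem ihn (ih _))

lemma ZqL_clear (c : K) (hc : c ∈ ZqL) : ∃ m : ℕ, qq ^ m * c ∈ Zq := by
  have h2 := qq_ne_zero
  unfold ZqL at hc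
  induction hc using Subring.closure_induction with
  | mem x hx =>
    rcases hx with rfl | hx
    · exact ⟨0, by simpa using qq_mem_Zq⟩
    · rw [Set.mem_singleton_iff] at hx
      subst hx
      exact ⟨1, by rw [pow_one, mul_inv_cancel₀ h2]; exact one_mem _⟩
  | zero => exact ⟨0, by simp⟩
  | one => exact ⟨0, by simp⟩
  | add x y _ _ hx hy =>
    obtain ⟨a, ha⟩ := hx
    obtain ⟨b, hb⟩ := hy
    refine ⟨a + b, ?_⟩
    have : qq ^ (a + b) * (x + y) = qq ^ b * (qq ^ a * x) + qq ^ a * (qq ^ b * y) := by ring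
    rw [this]
    exact add_mem (mul_mem (pow_mem qq_mem_Zq _) ha) (mul_mem (pow_mem qq_mem_Zq _) hb)
  | neg x _ hx =>
    obtain ⟨a, ha⟩ := hx
    exact ⟨a, by rw [mul_neg]; exact neg_mem ha⟩
  | mul x y _ _ hx hy =>
    obtain ⟨a, ha⟩ := hx
    obtain ⟨b, hb⟩ := hy
    refine ⟨a + b, ?_⟩
    have : qq ^ (a + b) * (x * y) = (qq ^ a * x) * (qq ^ b * y) := by ring
    rw [this]
    exact mul_mem ha hb

lemma eval_smul_ZqL (c : ↥ZqL) (P : K[X]) (x : K) : (c • P).eval x = (c : K) * P.eval x := by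
  rw [Subring.smul_def, eval_smul, smul_eq_mul]

lemma span_eval (P : K[X]) (hP : P ∈ Submodule.span (↥ZqL) (Set.range Bq)) (n : ℤ) :
    P.eval (qInt n) ∈ ZqL := by
  induction hP using Submodule.span_induction with
  | mem x hx => obtain ⟨k, rfl⟩ := hx; exact bv_mem_ZqL k n
  | zero => simp
  | add x y _ _ hx hy => rw [eval_add]; exact add_mem hx hy
  | smul a x _ hx => rw [eval_smul_ZqL]; exact mul_mem a.2 hx

lemma span_clear (P : K[X]) (hP : P ∈ Submodule.span (↥ZqL) (Set.range Bq)) :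
    ∃ m : ℕ, ∀ n : ℕ, qq ^ m * P.eval (qInt (n : ℤ)) ∈ Zq := by
  induction hP using Submodule.span_induction with
  | mem x hx =>
    obtain ⟨k, rfl⟩ := hx
    exact ⟨0, fun n => by rw [pow_zero, one_mul]; exact bv_mem_Zq k n⟩
  | zero => exact ⟨0, by simp⟩
  | add x y _ _ hx hy =>
    obtain ⟨a, ha⟩ := hx
    obtain ⟨b, hb⟩ := hy
    refine ⟨a + b, fun n => ?_⟩
    have : qq ^ (a + b) * (x + y).eval (qInt (n : ℤ))
        = qq ^ b * (qq ^ a * x.eval (qInt (n : ℤ))) + qq ^ a * (qq ^ b * y.eval (qInt (n : ℤ))) := by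
      rw [eval_add]; ring
    rw [this]
    exact add_mem (mul_mem (pow_mem qq_mem_Zq _) (ha n)) (mul_mem (pow_mem qq_mem_Zq _) (hb n))
  | smul c x _ hx =>
    obtain ⟨a, ha⟩ := hx
    obtain ⟨b, hb⟩ := ZqL_clear c c.2
    refine ⟨a + b, fun n => ?_⟩
    have : qq ^ (a + b) * (c • x).eval (qInt (n : ℤ))
        = (qq ^ b * (c : K)) * (qq ^ a * x.eval (qInt (n : ℤ))) := by
      rw [eval_smul_ZqL]; ring
    rw [this]
    exact mul_mem hb (ha n)

lemma Bq_degree (k : ℕ) : (Bq k).degree ≤ k := by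
  unfold Bq
  rw [← smul_eq_C_mul]
  refine (degree_smul_le _ _).trans ?_
  rw [degree_prod]
  simp only [degree_X_sub_C]
  simp

lemma interp (P : K[X]) (hP : ∀ n : ℕ, P.eval (qInt (n : ℤ)) ∈ ZqL) (N : ℕ) :
    ∃ Q ∈ Submodule.span (↥ZqL) (Set.range Bq), Q.degree < (N : WithBot ℕ) ∧
      ∀ n : ℕ, n < N → Q.eval (qInt (n : ℤ)) = P.eval (qInt (n : ℤ)) := by
  induction N with
  | zero => exact ⟨0, zero_mem _, by simp, fun n hn => by omega⟩
  | succ N ih =>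
    obtain ⟨Q, hQ, hd, he⟩ := ih
    let c : ↥ZqL := ⟨P.eval (qInt (N : ℤ)) - Q.eval (qInt (N : ℤ)),
      sub_mem (hP N) (span_eval Q hQ N)⟩
    refine ⟨Q + c • Bq N, add_mem hQ (Submodule.smul_mem _ _ (Submodule.subset_span ⟨N, rfl⟩)),
      ?_, ?_⟩
    · have hlt : (N : WithBot ℕ) < ((N + 1 : ℕ) : WithBot ℕ) := by
        exact_mod_cast Nat.lt_succ_self N
      refine lt_of_le_of_lt (degree_add_le _ _) (max_lt (hd.trans hlt) ?_)
      rw [Subring.smul_def]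
      exact lt_of_le_of_lt ((degree_smul_le _ _).trans (Bq_degree N)) hlt
    · intro n hn
      rw [eval_add, eval_smul_ZqL]
      change _ + _ * bv N n = _
      rcases Nat.lt_succ_iff_lt_or_eq.mp hn with h | rfl
      · rw [bv_lt N n h, mul_zero, add_zero, he n h]
      · rw [bv_self, mul_one]
        simp [c]

lemma mem_span_of_eval (P : K[X]) (hP : ∀ n : ℕ, P.eval (qInt (n : ℤ)) ∈ ZqL) :
    P ∈ Submodule.span (↥ZqL) (Set.range Bq) := by
  obtain ⟨Q, hQ, hd, he⟩ := interp P hP (P.natDegree + 1)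
  have hPd : P.degree < ((P.natDegree + 1 : ℕ) : WithBot ℕ) :=
    lt_of_le_of_lt degree_le_natDegree (by exact_mod_cast Nat.lt_succ_self _)
  have : P = Q := by
    refine Polynomial.eq_of_degrees_lt_of_eval_index_eq (Finset.range (P.natDegree + 1))
      (v := fun n : ℕ => qInt (n : ℤ)) (qInt_inj.injOn) (by simpa using hPd) (by simpa using hd) ?_
    intro i hi
    exact (he i (Finset.mem_range.mp hi)).symm
  rw [this]
  exact hQ

/-- A polynomial `P ∈ K[x]` satisfies `P([n]_q) ∈ ℤ[q,q⁻¹]` for all `n ∈ ℤ` iff it lies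
in the `ℤ[q,q⁻¹]`-linear span of the `B_q(k)`.  Equivalently, `R_q = R_q^+ ⊗_{ℤ[q]} ℤ[q,q⁻¹]`:
every such `P` has the form `q^{-m}·P₀` with `m ∈ ℕ` and `P₀ ∈ R_q^+`. -/
theorem quantum_integer_valued_on_int_iff (P : K[X]) :
    ((∀ n : ℤ, P.eval (qInt n) ∈ ZqL) ↔ P ∈ Submodule.span (↥ZqL) (Set.range Bq)) ∧
    ((∀ n : ℤ, P.eval (qInt n) ∈ ZqL) →
      ∃ (m : ℕ) (P₀ : K[X]), (∀ n : ℕ, P₀.eval (qInt (n : ℤ)) ∈ Zq) ∧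
        P = C (qq⁻¹ ^ m) * P₀) := by
  have h1 : (∀ n : ℤ, P.eval (qInt n) ∈ ZqL) → P ∈ Submodule.span (↥ZqL) (Set.range Bq) :=
    fun h => mem_span_of_eval P fun n => h n
  refine ⟨⟨h1, span_eval P⟩, fun h => ?_⟩
  obtain ⟨m, hm⟩ := span_clear P (h1 h)
  refine ⟨m, C (qq ^ m) * P, fun n => ?_, ?_⟩
  · rw [eval_mul, eval_C]
    exact hm n
  · rw [← mul_assoc, ← C_mul, inv_pow, inv_mul_cancel₀ (pow_ne_zero _ qq_ne_zero), C_1, one_mul]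
end
end

section
/- (q-Lucas theorem) Let d be a positive integer and n, m ∈ ℕ. Write n = d·n' + n₀ and m = d·m' + m₀ with n₀, m₀ ∈ {0, …, d−1}. Then qbinom(n,m) ≡ C(n',m')·qbinom(n₀,m₀) modulo Φ_d(q): there exists g in ℤ[q] (the image of the polynomial ring ℤ[q] inside K) such that qbinom(n,m) − C(n',m')·qbinom(n₀,m₀) = Φ_d(q)·g, where Φ_d(q) ∈ K is the d-th cyclotomic polynomial evaluated at q. -/
open Polynomial

noncomputable section

/-- The Gaussian binomial coefficient `qbinom(n,k) ∈ K`. -/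
def qBinom (n k : ℕ) : K := if k ≤ n then qFact n / (qFact k * qFact (n - k)) else 0

/-- Gaussian binomials by the Pascal recursion, in any commutative ring. -/
def gau {R : Type} [CommRing R] (q : R) : ℕ → ℕ → R
  | _, 0 => 1
  | 0, _ + 1 => 0
  | n + 1, k + 1 => gau q n k + q ^ (k + 1) * gau q n (k + 1)

theorem gau_zero_right {R : Type} [CommRing R] (q : R) (n : ℕ) : gau q n 0 = 1 := by
  cases n <;> simp [gau]

theorem gau_zero_succ {R : Type} [CommRing R] (q : R) (k : ℕ) : gau q 0 (k + 1) = 0 := by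
  simp [gau]

theorem gau_succ {R : Type} [CommRing R] (q : R) (n k : ℕ) :
    gau q (n + 1) (k + 1) = gau q n k + q ^ (k + 1) * gau q n (k + 1) := by
  simp [gau]

theorem gau_of_lt {R : Type} [CommRing R] (q : R) (n : ℕ) : ∀ k, n < k → gau q n k = 0 := by
  induction n with
  | zero =>
    intro k hk
    obtain ⟨k, rfl⟩ : ∃ j, k = j + 1 := ⟨k - 1, by omega⟩
    exact gau_zero_succ q k
  | succ n ih =>
    intro k hk
    obtain ⟨k, rfl⟩ : ∃ j, k = j + 1 := ⟨k - 1, by omega⟩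
    rw [gau_succ, ih k (by omega), ih (k + 1) (by omega)]
    simp

theorem gau_self {R : Type} [CommRing R] (q : R) (n : ℕ) : gau q n n = 1 := by
  induction n with
  | zero => exact gau_zero_right q 0
  | succ n ih => rw [gau_succ, ih, gau_of_lt q n (n + 1) (by omega)]; simp

theorem gau_map {R S : Type} [CommRing R] [CommRing S] (f : R →+* S) (q : R) (n : ℕ) :
    ∀ k, f (gau q n k) = gau (f q) n k := by
  induction n with
  | zero =>
    intro k
    cases k with
    | zero => simp [gau_zero_right]
    | succ k => simp [gau_zero_succ]
  | succ n ih =>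
    intro k
    cases k with
    | zero => simp [gau_zero_right]
    | succ k => simp [gau_succ, ih]

theorem gau_absorb {R : Type} [CommRing R] (q : R) (n : ℕ) :
    ∀ k, (q ^ (k + 1) - 1) * gau q (n + 1) (k + 1) = (q ^ (n + 1) - 1) * gau q n k := by
  induction n with
  | zero =>
    intro k
    cases k with
    | zero => simp [gau_succ, gau_zero_right, gau_zero_succ]
    | succ k => simp [gau_succ, gau_zero_succ]
  | succ n ih =>
    intro k
    rw [gau_succ]
    have h1 := ih k
    cases k with
    | zero =>
      rw [gau_zero_right] at *
      linear_combination q * h1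
    | succ k =>
      have h2 := ih k
      have h3 := gau_succ q n k
      linear_combination q ^ (k + 2) * h1 + q * h2 - q * (q ^ (n + 1) - 1) * h3

theorem gau_vanish {R : Type} [CommRing R] [IsDomain R] (q : R) (d : ℕ)
    (hq : IsPrimitiveRoot q d) (k : ℕ) (hk : k + 1 < d) : gau q d (k + 1) = 0 := by
  obtain ⟨e, rfl⟩ : ∃ e, d = e + 1 := ⟨d - 1, by omega⟩
  have h := gau_absorb q e k
  rw [hq.pow_eq_one, sub_self, zero_mul] at h
  rcases mul_eq_zero.1 h with h | h
  · exact absurd (sub_eq_zero.1 h) (hq.pow_ne_one_of_pos_of_lt (by omega) hk)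
  · exact h

theorem gau_lucas {R : Type} [CommRing R] [IsDomain R] (q : R) (d : ℕ) (hd : 0 < d)
    (hq : IsPrimitiveRoot q d) (n : ℕ) : ∀ n' n₀ m' m₀ : ℕ, n = d * n' + n₀ → n₀ < d → m₀ < d →
      gau q n (d * m' + m₀) = (n'.choose m' : R) * gau q n₀ m₀ := by
  have hpow : ∀ a b : ℕ, q ^ (d * a + b) = q ^ b := by
    intro a b
    rw [pow_add, pow_mul, hq.pow_eq_one, one_pow, one_mul]
  obtain ⟨e, rfl⟩ : ∃ e, d = e + 1 := ⟨d - 1, by omega⟩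
  induction n with
  | zero =>
    intro n' n₀ m' m₀ hn hn₀ hm₀
    obtain rfl : n₀ = 0 := by omega
    obtain rfl : n' = 0 := by
      rcases Nat.eq_zero_or_pos n' with h | h
      · exact h
      · have := Nat.mul_pos hd h
        omega
    cases m' with
    | zero => simp
    | succ m' =>
      rw [gau_of_lt q 0 _ (by rw [Nat.mul_succ]; omega)]
      simp
  | succ n ih =>
    intro n' n₀ m' m₀ hn hn₀ hm₀
    cases m₀ with
    | zero =>
      cases m' with
      | zero => simp [gau_zero_right]
      | succ m' =>
        have e1 : (e + 1) * (m' + 1) + 0 = ((e + 1) * m' + e) + 1 := by ring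
        have e2 : ((e + 1) * m' + e) + 1 = (e + 1) * (m' + 1) + 0 := by ring
        rw [e1, gau_succ, e2, hpow, pow_zero, one_mul, gau_zero_right]
        cases n₀ with
        | zero =>
          obtain ⟨n', rfl⟩ : ∃ j, n' = j + 1 := by
            refine ⟨n' - 1, ?_⟩
            rcases Nat.eq_zero_or_pos n' with h | h
            · subst h; omega
            · omega
          have hn2 : n = (e + 1) * n' + e := by
            rw [Nat.mul_succ] at hn; omega
          rw [ih n' e m' e hn2 (by omega) (by omega),
            ih n' e (m' + 1) 0 hn2 (by omega) (by omega), gau_self, gau_zero_right,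
            Nat.choose_succ_succ]
          push_cast
          ring
        | succ n₀ =>
          have hn2 : n = (e + 1) * n' + n₀ := by omega
          rw [ih n' n₀ m' e hn2 (by omega) (by omega),
            ih n' n₀ (m' + 1) 0 hn2 (by omega) (by omega), gau_of_lt q n₀ e (by omega),
            gau_zero_right]
          ring
    | succ k =>
      rw [← add_assoc, gau_succ, add_assoc, hpow]
      cases n₀ with
      | zero =>
        obtain ⟨n', rfl⟩ : ∃ j, n' = j + 1 := by
          refine ⟨n' - 1, ?_⟩
          rcases Nat.eq_zero_or_pos n' with h | h
          · subst h; omega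
          · omega
        have hn2 : n = (e + 1) * n' + e := by
          rw [Nat.mul_succ] at hn; omega
        rw [ih n' e m' k hn2 (by omega) (by omega),
          ih n' e m' (k + 1) hn2 (by omega) hm₀, gau_zero_succ]
        have h1 := gau_vanish q (e + 1) hq k hm₀
        rw [gau_succ] at h1
        linear_combination (n'.choose m' : R) * h1
      | succ n₀ =>
        have hn2 : n = (e + 1) * n' + n₀ := by omega
        rw [ih n' n₀ m' k hn2 (by omega) (by omega),
          ih n' n₀ m' (k + 1) hn2 (by omega) hm₀, gau_succ]
        ring

theorem qq_pow_ne (n : ℕ) : qq ^ (n + 1) - 1 ≠ 0 := by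
  intro h
  have h1 : (RatFunc.X : RatFunc ℚ) ^ (n + 1) = 1 := sub_eq_zero.1 h
  rw [← RatFunc.algebraMap_X, ← map_pow, ← map_one (algebraMap ℚ[X] (RatFunc ℚ))] at h1
  have h2 := congrArg natDegree (RatFunc.algebraMap_injective ℚ h1)
  simp at h2

theorem qInt_succ (n : ℕ) : qInt ((n : ℤ) + 1) = (qq ^ (n + 1) - 1) / (qq - 1) := by
  unfold qInt
  norm_cast

theorem qInt_ne (n : ℕ) : qInt ((n : ℤ) + 1) ≠ 0 := by
  rw [qInt_succ]
  refine div_ne_zero (qq_pow_ne n) ?_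
  simpa using qq_pow_ne 0

theorem qFact_ne (n : ℕ) : qFact n ≠ 0 :=
  Finset.prod_ne_zero_iff.2 fun i _ => qInt_ne i

theorem qFact_succ (n : ℕ) : qFact (n + 1) = qFact n * qInt ((n : ℤ) + 1) :=
  Finset.prod_range_succ _ _

theorem qBinom_eq (n : ℕ) : ∀ k, qBinom n k = gau qq n k := by
  induction n with
  | zero =>
    intro k
    cases k with
    | zero => simp [qBinom, qFact, gau_zero_right]
    | succ k => simp [qBinom, gau_zero_succ]
  | succ n ih =>
    intro k
    cases k with
    | zero =>
      have h0 : qFact 0 = 1 := by simp [qFact]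
      simp [qBinom, gau_zero_right, h0, qFact_ne]
    | succ k =>
      have h := gau_absorb qq n k
      rw [← ih k] at h
      apply mul_left_cancel₀ (qq_pow_ne k)
      rw [h]
      unfold qBinom
      by_cases hk : k ≤ n
      · have h1 : qq - 1 ≠ 0 := by simpa using qq_pow_ne 0
        have h2 := qq_pow_ne k
        have h3 := qFact_ne k
        have h4 := qFact_ne (n - k)
        rw [if_pos hk, if_pos (by omega), Nat.add_sub_add_right, qFact_succ, qFact_succ,
          qInt_succ, qInt_succ]
        field_simp
      · rw [if_neg hk, if_neg (by omega)]
        simp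

theorem aeval_mem_Zq (p : ℤ[X]) : aeval qq p ∈ Zq := by
  induction p using Polynomial.induction_on' with
  | add p r hp hr => rw [map_add]; exact Zq.add_mem hp hr
  | monomial n a =>
    rw [aeval_monomial]
    refine Zq.mul_mem ?_ (Zq.pow_mem (Subring.subset_closure rfl) n)
    simp

/-- The `q`-Lucas theorem: if `n = d·n' + n₀` and `m = d·m' + m₀` with `n₀, m₀ < d`, then
`qbinom(n,m) ≡ C(n',m')·qbinom(n₀,m₀) (mod Φ_d(q))`, where `Φ_d` is the `d`-th cyclotomic
polynomial. -/
theorem q_lucas (d : ℕ) (hd : 0 < d) (n m n' n₀ m' m₀ : ℕ)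
    (hn : n = d * n' + n₀) (hn₀ : n₀ < d) (hm : m = d * m' + m₀) (hm₀ : m₀ < d) :
    ∃ g ∈ Zq, qBinom n m - (n'.choose m' : K) * qBinom n₀ m₀ =
      (Polynomial.aeval qq (Polynomial.cyclotomic d ℤ)) * g := by
  have hζ := Complex.isPrimitiveRoot_exp d hd.ne'
  set ζ : ℂ := Complex.exp (2 * Real.pi * Complex.I / d) with hζdef
  have hdvd : cyclotomic d ℤ ∣ gau (X : ℤ[X]) n m - (n'.choose m' : ℤ[X]) * gau X n₀ m₀ := by
    rw [cyclotomic_eq_minpoly hζ hd]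
    refine minpoly.isIntegrallyClosed_dvd (hζ.isIntegral hd) ?_
    have hm1 : ∀ a b, aeval ζ (gau (X : ℤ[X]) a b) = gau ζ a b := by
      intro a b
      have := gau_map (aeval ζ : ℤ[X] →ₐ[ℤ] ℂ).toRingHom X a b
      simpa using this
    rw [map_sub, map_mul, map_natCast, hm1, hm1, hm,
      gau_lucas ζ d hd hζ n n' n₀ m' m₀ hn hn₀ hm₀, sub_self]
  obtain ⟨g, hg⟩ := hdvd
  refine ⟨aeval qq g, aeval_mem_Zq g, ?_⟩
  have hm2 : ∀ a b, aeval qq (gau (X : ℤ[X]) a b) = gau qq a b := by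
    intro a b
    have := gau_map (aeval qq : ℤ[X] →ₐ[ℤ] K).toRingHom X a b
    simpa using this
  rw [← map_mul, ← hg, map_sub, map_mul, map_natCast, hm2, hm2, qBinom_eq, qBinom_eq]
end
end
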